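/- arXiv:1907.12948 — 2 statements merged into one kernel-verified Lean document; each statement's English description precedes it below -/
import Mathlib

section
/- Let A be an m×n matrix over 𝔼 with minor rank mr(A) = r. Then there exists a set of r row vectors of A that is linearly independent. As a consequence, the row rank satisfies r(A) ≥ mr(A). -/
open scoped Pointwise Classical

noncomputable section

-- Note: `ℝ*` is Mathlib's notation for the hyperreals `Hyperreal`.

/-- A neutrix: an order-convex additive subgroup of the hyperreals. -/
def IsNeutrix (A : Set ℝ*) : Prop :=
  (0 : ℝ*) ∈ A ∧ (∀ x ∈ A, ∀ y ∈ A, x + y ∈ A) ∧ (∀ x ∈ A, -x ∈ A) ∧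
    ∀ x ∈ A, ∀ y ∈ A, ∀ z : ℝ*, x ≤ z → z ≤ y → z ∈ A

/-- The coset `a + A`. -/
def coset (a : ℝ*) (A : Set ℝ*) : Set ℝ* := {x | ∃ u ∈ A, x = a + u}

/-- `α` is an external number: a coset of a neutrix. -/
def IsExt (α : Set ℝ*) : Prop := ∃ a A, IsNeutrix A ∧ α = coset a A

/-- The neutrix part `N(α)` of an external number, as the set of differences. -/
def Nx (α : Set ℝ*) : Set ℝ* := {d | ∃ x ∈ α, ∃ y ∈ α, d = x - y}

/-- An external number is zeroless if it does not contain `0`. -/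
def Zeroless (α : Set ℝ*) : Prop := (0 : ℝ*) ∉ α

/-- Multiplication of external numbers: `αβ = ab + aB + bA + AB`
(independent of the chosen representatives). -/
def emul (α β : Set ℝ*) : Set ℝ* :=
  {z | ∃ a A b B, IsNeutrix A ∧ IsNeutrix B ∧ α = coset a A ∧ β = coset b B ∧
      ∃ u ∈ A, ∃ v ∈ B, ∃ u' ∈ A, ∃ v' ∈ B, z = a * b + a * v + b * u + u' * v'}

/-- Multiplication of an external number by a hyperreal scalar: `t·α = ta + tA`. -/
def esmul (t : ℝ*) (α : Set ℝ*) : Set ℝ* := (fun x => t * x) '' α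

/-- Inverse of a (zeroless) external number: `1/α = 1/a + A/a²`. -/
def einv (α : Set ℝ*) : Set ℝ* :=
  {z | ∃ a A, IsNeutrix A ∧ α = coset a A ∧ ∃ u ∈ A, z = a⁻¹ + u / a ^ 2}

/-- Division of external numbers: `α/β = α · (1/β)`. -/
def ediv (α β : Set ℝ*) : Set ℝ* := emul α (einv β)

/-- The neutrix `⊘` of infinitesimal hyperreals. -/
def oslash : Set ℝ* := {x | Hyperreal.Infinitesimal x}

/-- Relative uncertainty `R(α)`: `A/a` if `α = a + A` is zeroless,
and all of `ℝ*` if `α` is a neutrix. -/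
def RU (α : Set ℝ*) : Set ℝ* :=
  if (0 : ℝ*) ∈ α then Set.univ
  else {z | ∃ a A, IsNeutrix A ∧ α = coset a A ∧ ∃ u ∈ A, z = u / a}

/-- `α` and `β` are nearly opposite: both zeroless and `α/β ⊆ -1 + ⊘`. -/
def NearlyOpposite (α β : Set ℝ*) : Prop :=
  Zeroless α ∧ Zeroless β ∧ ediv α β ⊆ coset (-1) oslash

/-- Order on external numbers: `α ≤ β` iff `∀ x ∈ α, ∃ y ∈ β, x ≤ y`. -/
def ele (α β : Set ℝ*) : Prop := ∀ x ∈ α, ∃ y ∈ β, x ≤ y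

/-- `α` is non-negative: some element of `α` is `≥ 0`. -/
def eNonneg (α : Set ℝ*) : Prop := ∃ x ∈ α, (0 : ℝ*) ≤ x

/-- Absolute value of an external number: `|α| = |a| + A`. -/
def eabs (α : Set ℝ*) : Set ℝ* :=
  {z | ∃ a A, IsNeutrix A ∧ α = coset a A ∧ ∃ u ∈ A, z = |a| + u}

/-- Product of a finite family of external numbers. -/
def eprod : ∀ {n : ℕ}, (Fin n → Set ℝ*) → Set ℝ*
  | 0, _ => {1}
  | _ + 1, f => emul (f 0) (eprod fun i => f i.succ)

/-- Power of an external number. -/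
def epow (α : Set ℝ*) : ℕ → Set ℝ*
  | 0 => {1}
  | k + 1 => emul α (epow α k)

/-- Matrix product over external numbers: `(AB)_{ij} = Σ_k α_{ik}β_{kj}`. -/
def matMul {m n p : ℕ} (M : Matrix (Fin m) (Fin n) (Set ℝ*))
    (N : Matrix (Fin n) (Fin p) (Set ℝ*)) : Matrix (Fin m) (Fin p) (Set ℝ*) :=
  fun i j => ∑ k, emul (M i k) (N k j)

/-- Entrywise (Minkowski) sum of matrices over external numbers. -/
def matAdd {m n : ℕ} (M N : Matrix (Fin m) (Fin n) (Set ℝ*)) :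
    Matrix (Fin m) (Fin n) (Set ℝ*) := fun i j => M i j + N i j

/-- Entrywise scalar multiple of a matrix by an external number. -/
def matSmul {m n : ℕ} (α : Set ℝ*) (M : Matrix (Fin m) (Fin n) (Set ℝ*)) :
    Matrix (Fin m) (Fin n) (Set ℝ*) := fun i j => emul α (M i j)

/-- Entrywise inclusion of matrices over external numbers. -/
def matIncl {m n : ℕ} (M N : Matrix (Fin m) (Fin n) (Set ℝ*)) : Prop :=
  ∀ i j, M i j ⊆ N i j

/-- Determinant of a square matrix over the external numbers. -/
def detE {n : ℕ} (M : Matrix (Fin n) (Fin n) (Set ℝ*)) : Set ℝ* :=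
  ∑ σ : Equiv.Perm (Fin n),
    esmul ((Equiv.Perm.sign σ : ℤ) : ℝ*) (eprod fun i => M i (σ i))

/-- The `(i,j)` minor of a square matrix over the external numbers. -/
def minorE {n : ℕ} (M : Matrix (Fin (n + 1)) (Fin (n + 1)) (Set ℝ*))
    (i j : Fin (n + 1)) : Set ℝ* :=
  detE (M.submatrix i.succAbove j.succAbove)

/-- The near-identity matrix `I_n(N)`: diagonal entries `1 + N`, off-diagonal entries `N`. -/
def Iun (n : ℕ) (N : Set ℝ*) : Matrix (Fin n) (Fin n) (Set ℝ*) :=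
  fun i j => if i = j then coset 1 N else N

/-- A finite family of vectors of external numbers is linearly dependent:
some nontrivial real (hyperreal) linear combination is a neutrix vector. -/
def LinDepE {ι : Type*} [Fintype ι] {n : ℕ} (ξ : ι → Fin n → Set ℝ*) : Prop :=
  ∃ t : ι → ℝ*, (∃ i, t i ≠ 0) ∧ ∃ A : Fin n → Set ℝ*,
    (∀ j, IsNeutrix (A j)) ∧ ∀ j, (∑ i, esmul (t i) (ξ i j)) = A j

/-- The matrix has a zeroless minor of order `k`. -/
def HasZerolessMinor {m n : ℕ} (M : Matrix (Fin m) (Fin n) (Set ℝ*)) (k : ℕ) : Prop :=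
  ∃ (f : Fin k → Fin m) (g : Fin k → Fin n), Function.Injective f ∧ Function.Injective g ∧
    Zeroless (detE fun i j => M (f i) (g j))

/-- The minor rank of `M` is `r`. -/
def minorRankIs {m n : ℕ} (M : Matrix (Fin m) (Fin n) (Set ℝ*)) (r : ℕ) : Prop :=
  HasZerolessMinor M r ∧ ∀ k, HasZerolessMinor M k → k ≤ r

/-- The row rank of `M` is `r`: the maximal cardinality of a linearly
independent set of row vectors of `M` is `r`. -/
def rowRankIs {m n : ℕ} (M : Matrix (Fin m) (Fin n) (Set ℝ*)) (r : ℕ) : Prop :=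
  (∃ s : Finset (Fin m), s.card = r ∧ ¬ LinDepE fun (i : {x // x ∈ s}) j => M i.1 j) ∧
  ∀ s : Finset (Fin m), (¬ LinDepE fun (i : {x // x ∈ s}) j => M i.1 j) → s.card ≤ r

/-- `M` is a reduced matrix: `max_{i,j} |α_{ij}| = 1 + A₀` for some neutrix `A₀ ⊆ ⊘`. -/
def IsReducedMat {m n : ℕ} (M : Matrix (Fin m) (Fin n) (Set ℝ*)) : Prop :=
  ∃ A₀, IsNeutrix A₀ ∧ A₀ ⊆ oslash ∧ (∃ i j, eabs (M i j) = coset 1 A₀) ∧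
    ∀ i j, ele (eabs (M i j)) (coset 1 A₀)

/-- A neutrix is solid: it contains every element dominated in absolute value. -/
lemma IsNeutrix.mem_of_abs_le {A : Set ℝ*} (hA : IsNeutrix A) {x z : ℝ*} (hx : x ∈ A)
    (h : |z| ≤ |x|) : z ∈ A := by
  obtain ⟨-, -, hneg, hconv⟩ := hA
  obtain ⟨h₁, h₂⟩ := abs_le.mp h
  rcases abs_cases x with ⟨e, -⟩ | ⟨e, -⟩ <;> rw [e] at h₁ h₂
  · exact hconv _ (hneg x hx) _ hx z h₁ h₂
  · exact hconv _ hx _ (hneg x hx) z (by simpa using h₁) h₂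

lemma IsNeutrix.of_solid {A : Set ℝ*} (h0 : (0 : ℝ*) ∈ A)
    (hadd : ∀ x ∈ A, ∀ y ∈ A, x + y ∈ A) (hsolid : ∀ x ∈ A, ∀ z, |z| ≤ |x| → z ∈ A) :
    IsNeutrix A := by
  refine ⟨h0, hadd, fun x hx => hsolid x hx _ (abs_neg x).le, fun x hx y hy z h₁ h₂ => ?_⟩
  rcases le_total |x| |y| with h | h
  · exact hsolid y hy z ((abs_le_max_abs_abs h₁ h₂).trans (max_le h le_rfl))
  · exact hsolid x hx z ((abs_le_max_abs_abs h₁ h₂).trans (max_le le_rfl h))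

lemma isNeutrix_singleton_zero : IsNeutrix {0} :=
  .of_solid rfl (by simp) (by simp)

lemma IsNeutrix.add {A B : Set ℝ*} (hA : IsNeutrix A) (hB : IsNeutrix B) :
    IsNeutrix (A + B) := by
  refine .of_solid ⟨0, hA.1, 0, hB.1, add_zero 0⟩ ?_ ?_
  · rintro _ ⟨a, ha, b, hb, rfl⟩ _ ⟨a', ha', b', hb', rfl⟩
    exact ⟨a + a', hA.2.1 _ ha _ ha', b + b', hB.2.1 _ hb _ hb', add_add_add_comm ..⟩
  · rintro _ ⟨a, ha, b, hb, rfl⟩ z hz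
    have hz' : |z| ≤ |a| + |b| := hz.trans (abs_add_le a b)
    rcases le_total |a| |b| with h | h
    · refine ⟨0, hA.1, z, hB.mem_of_abs_le (hB.2.1 b hb b hb) ?_, zero_add z⟩
      rw [← two_mul, abs_mul, abs_two]
      linarith
    · refine ⟨z, hA.mem_of_abs_le (hA.2.1 a ha a ha) ?_, 0, hB.1, add_zero z⟩
      rw [← two_mul, abs_mul, abs_two]
      linarith

lemma IsNeutrix.mul {A B : Set ℝ*} (hA : IsNeutrix A) (hB : IsNeutrix B) :
    IsNeutrix (A * B) := by
  have hsolid : ∀ x ∈ A * B, ∀ z, |z| ≤ |x| → z ∈ A * B := by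
    rintro _ ⟨u, hu, v, hv, rfl⟩ z hz
    change |z| ≤ |u * v| at hz
    rcases eq_or_ne v 0 with rfl | hv0
    · have hz0 : z = 0 := by simpa using hz
      exact ⟨0, hA.1, 0, hB.1, by simp [hz0]⟩
    · refine ⟨z / v, hA.mem_of_abs_le hu ?_, v, hv, div_mul_cancel₀ z hv0⟩
      rwa [abs_div, div_le_iff₀ (abs_pos.mpr hv0), ← abs_mul]
  refine .of_solid ⟨0, hA.1, 0, hB.1, mul_zero 0⟩ ?_ hsolid
  rintro _ ⟨u, hu, v, hv, rfl⟩ _ ⟨u', hu', v', hv', rfl⟩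
  have hadd : |u| + |u'| ∈ A :=
    hA.2.1 _ (hA.mem_of_abs_le hu (abs_abs u).le) _ (hA.mem_of_abs_le hu' (abs_abs u').le)
  have key : ∀ w ∈ B, |v| ≤ |w| → |v'| ≤ |w| → u * v + u' * v' ∈ A * B := by
    intro w hw h h'
    refine hsolid _ ⟨_, hadd, w, hw, rfl⟩ _ ((abs_add_le _ _).trans ?_)
    simp only [abs_mul]
    rw [abs_of_nonneg (by positivity : 0 ≤ |u| + |u'|), add_mul]
    gcongr
  rcases le_total |v| |v'| with h | h
  · exact key v' hv' h le_rfl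
  · exact key v hv le_rfl h

lemma IsNeutrix.esmul {B : Set ℝ*} (hB : IsNeutrix B) (a : ℝ*) : IsNeutrix (esmul a B) := by
  refine .of_solid ⟨0, hB.1, mul_zero a⟩ ?_ ?_
  · rintro _ ⟨v, hv, rfl⟩ _ ⟨w, hw, rfl⟩
    exact ⟨v + w, hB.2.1 _ hv _ hw, mul_add a v w⟩
  · rintro _ ⟨v, hv, rfl⟩ z hz
    change |z| ≤ |a * v| at hz
    rcases eq_or_ne a 0 with rfl | ha
    · have hz0 : z = 0 := by simpa using hz
      exact ⟨0, hB.1, by simp [hz0]⟩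
    · refine ⟨z / a, hB.mem_of_abs_le hv ?_, mul_div_cancel₀ z ha⟩
      rwa [abs_div, div_le_iff₀' (abs_pos.mpr ha), ← abs_mul]

lemma mem_coset_iff {a x : ℝ*} {A : Set ℝ*} : x ∈ coset a A ↔ x - a ∈ A := by
  constructor
  · rintro ⟨u, hu, rfl⟩
    simpa using hu
  · exact fun h => ⟨x - a, h, by ring⟩

/-- Every element of a coset of a neutrix is a representative of it. -/
lemma coset_eq_of_mem {a x : ℝ*} {A : Set ℝ*} (hA : IsNeutrix A) (hx : x ∈ coset a A) :
    coset a A = coset x A := by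
  obtain ⟨u, hu, rfl⟩ := hx
  ext y
  simp only [mem_coset_iff]
  constructor <;> intro h
  · simpa [sub_eq_add_neg, add_assoc, add_comm, add_left_comm] using hA.2.1 _ h _ (hA.2.2.1 u hu)
  · simpa [← sub_sub] using hA.2.1 _ h _ hu

lemma mem_coset_self {A : Set ℝ*} (hA : IsNeutrix A) (a : ℝ*) : a ∈ coset a A :=
  ⟨0, hA.1, (add_zero a).symm⟩

/-- The neutrix part of an external number is uniquely determined. -/
lemma eq_of_coset_eq_coset {a b : ℝ*} {A B : Set ℝ*} (hB : IsNeutrix B)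
    (hA : IsNeutrix A) (h : coset a A = coset b B) : A = B := by
  have hab : coset a A = coset a B := by
    rw [h]; exact coset_eq_of_mem hB (h ▸ mem_coset_self hA a)
  ext u
  simpa [mem_coset_iff] using Set.ext_iff.mp hab (a + u)

lemma mul_mem_emul {α β : Set ℝ*} (hα : IsExt α) (hβ : IsExt β) {x y : ℝ*} (hx : x ∈ α)
    (hy : y ∈ β) : x * y ∈ emul α β := by
  obtain ⟨a, A, hA, rfl⟩ := hα
  obtain ⟨b, B, hB, rfl⟩ := hβ
  exact ⟨x, A, y, B, hA, hB, coset_eq_of_mem hA hx, coset_eq_of_mem hB hy,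
    0, hA.1, 0, hB.1, 0, hA.1, 0, hB.1, by ring⟩

lemma emul_coset {a b : ℝ*} {A B : Set ℝ*} (hA : IsNeutrix A) (hB : IsNeutrix B) :
    emul (coset a A) (coset b B) = coset (a * b) (esmul a B + esmul b A + A * B) := by
  ext z
  constructor
  · rintro ⟨a', A', b', B', hA', hB', hα, hβ, u, hu, v, hv, u', hu', v', hv', rfl⟩
    obtain rfl := eq_of_coset_eq_coset hA' hA hα
    obtain rfl := eq_of_coset_eq_coset hB' hB hβ
    obtain ⟨p, hp, rfl⟩ : a' ∈ coset a A := hα ▸ mem_coset_self hA a'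
    obtain ⟨q, hq, rfl⟩ : b' ∈ coset b B := hβ ▸ mem_coset_self hB b'
    have hAB := (hA.mul hB).2.1
    refine ⟨_, ⟨_, ⟨_, ⟨q + v, hB.2.1 _ hq _ hv, rfl⟩, _, ⟨p + u, hA.2.1 _ hp _ hu, rfl⟩, rfl⟩,
      p * (q + v) + (u * q + u' * v'),
      hAB _ (Set.mul_mem_mul hp (hB.2.1 _ hq _ hv)) _
        (hAB _ (Set.mul_mem_mul hu hq) _ (Set.mul_mem_mul hu' hv')), rfl⟩, ?_⟩
    ring
  · rintro ⟨_, ⟨_, ⟨_, ⟨v, hv, rfl⟩, _, ⟨u, hu, rfl⟩, rfl⟩, _, ⟨u', hu', v', hv', rfl⟩, rfl⟩, rfl⟩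
    exact ⟨a, A, b, B, hA, hB, rfl, rfl, u, hu, v, hv, u', hu', v', hv', by ring⟩

lemma IsExt.emul {α β : Set ℝ*} (hα : IsExt α) (hβ : IsExt β) : IsExt (emul α β) := by
  obtain ⟨a, A, hA, rfl⟩ := hα
  obtain ⟨b, B, hB, rfl⟩ := hβ
  exact ⟨_, _, ((hB.esmul a).add (hA.esmul b)).add (hA.mul hB), emul_coset hA hB⟩

lemma isExt_singleton_one : IsExt {1} :=
  ⟨1, {0}, isNeutrix_singleton_zero, by ext; simp [coset]⟩

lemma IsExt.eprod : ∀ {k : ℕ} {F : Fin k → Set ℝ*}, (∀ i, IsExt (F i)) → IsExt (eprod F)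
  | 0, _, _ => isExt_singleton_one
  | _ + 1, _, hF => (hF 0).emul (IsExt.eprod fun i => hF i.succ)

lemma prod_mem_eprod : ∀ {k : ℕ} {F : Fin k → Set ℝ*} (_ : ∀ i, IsExt (F i)) {x : Fin k → ℝ*}
    (_ : ∀ i, x i ∈ F i), ∏ i, x i ∈ eprod F
  | 0, _, _, _, _ => by simp [eprod]
  | _ + 1, _, hF, _, hx => by
    rw [Fin.prod_univ_succ]
    exact mul_mem_emul (hF 0) (IsExt.eprod fun i => hF i.succ) (hx 0)
      (prod_mem_eprod (fun i => hF i.succ) fun i => hx i.succ)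

/-- The determinant of a matrix of representatives represents the determinant. -/
lemma det_mem_detE {k : ℕ} {M : Matrix (Fin k) (Fin k) (Set ℝ*)} (hM : ∀ i j, IsExt (M i j))
    {B : Matrix (Fin k) (Fin k) ℝ*} (hB : ∀ i j, B i j ∈ M i j) : B.det ∈ detE M := by
  rw [← Matrix.det_transpose, Matrix.det_apply']
  exact Set.finsetSum_mem_finsetSum _ _ _ fun σ _ =>
    ⟨_, prod_mem_eprod (fun i => hM i (σ i)) fun i => hB i (σ i), rfl⟩

/-- Dependent vectors have representatives satisfying the same linear relation exactly. -/
lemma LinDepE.exists_representatives {ι : Type*} [Fintype ι] {n : ℕ}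
    {ξ : ι → Fin n → Set ℝ*} (h : LinDepE ξ) :
    ∃ t : ι → ℝ*, (∃ i, t i ≠ 0) ∧ ∃ x : ι → Fin n → ℝ*,
      (∀ i j, x i j ∈ ξ i j) ∧ ∀ j, ∑ i, t i * x i j = 0 := by
  obtain ⟨t, ht, N, hN, hsum⟩ := h
  have hrep : ∀ j, ∃ y : ι → ℝ*, (∀ i, y i ∈ ξ i j) ∧ ∑ i, t i * y i = 0 := by
    intro j
    have h0 : (0 : ℝ*) ∈ ∑ i, esmul (t i) (ξ i j) := hsum j ▸ (hN j).1
    obtain ⟨g, hg, hg0⟩ := Set.mem_fintype_sum _ _ |>.mp h0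
    choose y hy hyg using hg
    exact ⟨y, hy, by rw [← hg0]; exact Finset.sum_congr rfl fun i _ => hyg i⟩
  choose y hy hy0 using hrep
  exact ⟨t, ht, fun i j => y j i, fun i j => hy j i, hy0⟩

theorem stmt17 {m n : ℕ} (A : Matrix (Fin m) (Fin n) (Set ℝ*)) (hA : ∀ i j, IsExt (A i j))
    (r : ℕ) (hmr : minorRankIs A r) :
    (∃ s : Finset (Fin m), s.card = r ∧ ¬ LinDepE fun (i : {x // x ∈ s}) j => A i.1 j) ∧
      ∀ rr, rowRankIs A rr → r ≤ rr := by
  have indep : ∃ s : Finset (Fin m), s.card = r ∧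
      ¬ LinDepE fun (i : {x // x ∈ s}) j => A i.1 j := by
    obtain ⟨⟨f, g, hf, -, hdet⟩, -⟩ := hmr
    refine ⟨Finset.univ.map ⟨f, hf⟩, by simp, fun hdep => hdet ?_⟩
    obtain ⟨t, ⟨i₀, hi₀⟩, x, hx, hx0⟩ := hdep.exists_representatives
    let e : Fin r ≃ {x // x ∈ Finset.univ.map ⟨f, hf⟩} :=
      Equiv.ofBijective (fun k => ⟨f k, by simp⟩)
        ⟨fun k l h => hf (Subtype.ext_iff.mp h), by
          rintro ⟨i, hi⟩
          obtain ⟨k, -, rfl⟩ := Finset.mem_map.mp hi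
          exact ⟨k, rfl⟩⟩
    let B : Matrix (Fin r) (Fin r) ℝ* := fun k l => x (e k) (g l)
    have hB : B.det = 0 := by
      refine Matrix.exists_vecMul_eq_zero_iff.mp ⟨t ∘ e, fun h => hi₀ ?_, ?_⟩
      · simpa using congrFun h (e.symm i₀)
      · ext l
        exact (e.sum_comp fun i => t i * x i (g l)).trans (hx0 (g l))
    exact hB ▸ det_mem_detE (fun k l => hA (f k) (g l)) fun k l => hx (e k) (g l)
  obtain ⟨s, hs, hind⟩ := indep
  exact ⟨⟨s, hs, hind⟩, fun rr hrr => hs ▸ hrr.2 s hind⟩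
end
end

section
/- Let A = (α_{ij}) = (a_{ij} + A_{ij}) be an m×n reduced matrix over 𝔼 with minor rank mr(A) = 1 and α₁₁ zeroless. Write Ā₁ = max_{1≤i≤m} A_{i1}. Suppose either (i) Ā₁/α₁₁ ⊆ A_{ij} for all 1 ≤ i ≤ m and 2 ≤ j ≤ n, or (ii) all neutrix parts A_{ij} (1 ≤ i ≤ m, 1 ≤ j ≤ n) are equal to one common neutrix A. Then r(A) = 1 and sr(A) = 1. -/
open scoped Pointwise Classical

noncomputable section

namespace IsNeutrix

variable {A B : Set ℝ*}

theorem zero_mem (hA : IsNeutrix A) : (0 : ℝ*) ∈ A := hA.1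

theorem add_mem (hA : IsNeutrix A) {x y : ℝ*} (hx : x ∈ A) (hy : y ∈ A) : x + y ∈ A :=
  hA.2.1 x hx y hy

theorem neg_mem (hA : IsNeutrix A) {x : ℝ*} (hx : x ∈ A) : -x ∈ A := hA.2.2.1 x hx

theorem sub_mem (hA : IsNeutrix A) {x y : ℝ*} (hx : x ∈ A) (hy : y ∈ A) : x - y ∈ A := by
  rw [sub_eq_add_neg]
  exact hA.add_mem hx (hA.neg_mem hy)

theorem abs_mem (hA : IsNeutrix A) {x : ℝ*} (hx : x ∈ A) : |x| ∈ A := by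
  rcases abs_choice x with h | h <;> rw [h]
  · exact hx
  · exact hA.neg_mem hx

theorem mem_of_abs_le_s19 (hA : IsNeutrix A) {x z : ℝ*} (hx : x ∈ A) (h : |z| ≤ x) : z ∈ A :=
  hA.2.2.2 (-x) (hA.neg_mem hx) x hx z (abs_le.1 h).1 (abs_le.1 h).2

theorem natCast_mul_mem (hA : IsNeutrix A) {x : ℝ*} (hx : x ∈ A) (k : ℕ) : (k : ℝ*) * x ∈ A := by
  induction k with
  | zero => simpa using hA.zero_mem
  | succ k ih =>
    push_cast
    rw [add_mul, one_mul]
    exact hA.add_mem ih hx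

theorem ofNat_mul_mem (hA : IsNeutrix A) {x : ℝ*} (hx : x ∈ A) (k : ℕ) [k.AtLeastTwo] :
    (OfNat.ofNat k : ℝ*) * x ∈ A := by
  rw [← Nat.cast_ofNat]
  exact hA.natCast_mul_mem hx _

theorem singleton_zero : IsNeutrix ({0} : Set ℝ*) := by
  refine ⟨rfl, ?_, ?_, ?_⟩
  · rintro x rfl y rfl
    simp
  · rintro x rfl
    simp
  · rintro x rfl y rfl z h1 h2
    exact le_antisymm h2 h1

theorem add_s19 (hA : IsNeutrix A) (hB : IsNeutrix B) : IsNeutrix (A + B) := by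
  refine ⟨⟨0, hA.zero_mem, 0, hB.zero_mem, add_zero 0⟩, ?_, ?_, ?_⟩
  · rintro _ ⟨a, ha, b, hb, rfl⟩ _ ⟨a', ha', b', hb', rfl⟩
    exact ⟨a + a', hA.add_mem ha ha', b + b', hB.add_mem hb hb', by ring⟩
  · rintro _ ⟨a, ha, b, hb, rfl⟩
    exact ⟨-a, hA.neg_mem ha, -b, hB.neg_mem hb, by ring⟩
  · rintro _ ⟨a, ha, b, hb, rfl⟩ _ ⟨a', ha', b', hb', rfl⟩ z h1 h2
    simp only at h1 h2
    have hz : |z| ≤ (|a| + |a'|) + (|b| + |b'|) := by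
      rw [abs_le]
      constructor <;>
        linarith [neg_abs_le a, neg_abs_le b, le_abs_self a', le_abs_self b', abs_nonneg a,
          abs_nonneg a', abs_nonneg b, abs_nonneg b']
    have hp := hA.add_mem (hA.abs_mem ha) (hA.abs_mem ha')
    have hq := hB.add_mem (hB.abs_mem hb) (hB.abs_mem hb')
    rcases le_total (|a| + |a'|) (|b| + |b'|) with h | h
    · exact ⟨0, hA.zero_mem, z, hB.mem_of_abs_le_s19 (hB.ofNat_mul_mem hq 2) (by linarith),
        zero_add z⟩
    · exact ⟨z, hA.mem_of_abs_le_s19 (hA.ofNat_mul_mem hp 2) (by linarith), 0, hB.zero_mem,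
        add_zero z⟩

theorem mul_image (hA : IsNeutrix A) (t : ℝ*) : IsNeutrix ((fun x => t * x) '' A) := by
  rcases eq_or_ne t 0 with rfl | ht
  · convert singleton_zero
    ext x
    simp only [zero_mul, Set.mem_image, Set.mem_singleton_iff]
    exact ⟨fun ⟨_, _, h⟩ => h.symm, fun h => ⟨0, hA.zero_mem, h.symm⟩⟩
  refine ⟨⟨0, hA.zero_mem, mul_zero t⟩, ?_, ?_, ?_⟩
  · rintro _ ⟨a, ha, rfl⟩ _ ⟨b, hb, rfl⟩
    exact ⟨a + b, hA.add_mem ha hb, by ring⟩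
  · rintro _ ⟨a, ha, rfl⟩
    exact ⟨-a, hA.neg_mem ha, by ring⟩
  · rintro _ ⟨a, ha, rfl⟩ _ ⟨b, hb, rfl⟩ z h1 h2
    simp only at h1 h2
    have hz : t * (z / t) = z := by field_simp
    refine ⟨z / t, ?_, hz⟩
    rw [← hz] at h1 h2
    rcases ht.lt_or_gt with h | h
    · exact hA.2.2.2 b hb a ha _ ((mul_le_mul_left_of_neg h).1 h2)
        ((mul_le_mul_left_of_neg h).1 h1)
    · exact hA.2.2.2 a ha b hb _ (le_of_mul_le_mul_left h1 h) (le_of_mul_le_mul_left h2 h)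

/-- A hyperreal bounded by `|x| p + |y| q` splits along the neutrices containing `p` and `q`. -/
theorem exists_eq_mul_add_mul (hA : IsNeutrix A) (hB : IsNeutrix B) {s x y p q : ℝ*}
    (hp : p ∈ A) (hq : q ∈ B) (h : |s| ≤ |x| * p + |y| * q) :
    ∃ c ∈ A, ∃ d ∈ B, s = x * c + y * d := by
  have key : ∀ {C : Set ℝ*} {w r : ℝ*}, IsNeutrix C → r ∈ C → |s| ≤ 2 * (|w| * r) →
      ∃ c ∈ C, s = w * c := by
    intro C w r hC hr hs
    rcases eq_or_ne w 0 with rfl | hw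
    · refine ⟨0, hC.zero_mem, ?_⟩
      have : |s| ≤ 0 := by simpa using hs
      simpa using this
    · refine ⟨s / w, hC.mem_of_abs_le_s19 (hC.ofNat_mul_mem hr 2) ?_, by field_simp⟩
      rw [abs_div, div_le_iff₀ (abs_pos.2 hw)]
      linarith
  rcases le_total (|x| * p) (|y| * q) with hle | hle
  · obtain ⟨d, hd, hs⟩ := key (w := y) hB hq (by linarith)
    exact ⟨0, hA.zero_mem, d, hd, by simpa using hs⟩
  · obtain ⟨c, hc, hs⟩ := key (w := x) hA hp (by linarith)
    exact ⟨c, hc, 0, hB.zero_mem, by simpa using hs⟩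

end IsNeutrix

theorem Nx_coset {a : ℝ*} {A : Set ℝ*} (hA : IsNeutrix A) : Nx (coset a A) = A := by
  ext d
  constructor
  · rintro ⟨_, ⟨u, hu, rfl⟩, _, ⟨v, hv, rfl⟩, rfl⟩
    simpa using hA.sub_mem hu hv
  · exact fun hd => ⟨a + d, ⟨d, hd, rfl⟩, a, ⟨0, hA.zero_mem, by simp⟩, by simp⟩

theorem coset_zero (A : Set ℝ*) : coset 0 A = A := by
  ext x
  simp [coset]

namespace IsExt

variable {α β : Set ℝ*}

theorem nonempty (h : IsExt α) : ∃ a, a ∈ α := by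
  obtain ⟨a, A, hA, rfl⟩ := h
  exact ⟨a, 0, hA.zero_mem, by simp⟩

theorem isNeutrix_Nx (h : IsExt α) : IsNeutrix (Nx α) := by
  obtain ⟨a, A, hA, rfl⟩ := h
  rwa [Nx_coset hA]

theorem mem_iff (h : IsExt α) {x y : ℝ*} (hx : x ∈ α) : y ∈ α ↔ y - x ∈ Nx α := by
  refine ⟨fun hy => ⟨y, hy, x, hx, rfl⟩, fun hyx => ?_⟩
  obtain ⟨a, A, hA, rfl⟩ := h
  obtain ⟨u, hu, rfl⟩ := hx
  rw [Nx_coset hA] at hyx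
  exact ⟨u + (y - (a + u)), hA.add_mem hu hyx, by ring⟩

theorem add_mem (h : IsExt α) {x u : ℝ*} (hx : x ∈ α) (hu : u ∈ Nx α) : x + u ∈ α :=
  (h.mem_iff hx).2 (by simpa using hu)

theorem sub_mem (h : IsExt α) {x u : ℝ*} (hx : x ∈ α) (hu : u ∈ Nx α) : x - u ∈ α := by
  rw [sub_eq_add_neg]
  exact h.add_mem hx (h.isNeutrix_Nx.neg_mem hu)

theorem eq_coset (h : IsExt α) {x : ℝ*} (hx : x ∈ α) : α = coset x (Nx α) := by
  ext y
  rw [h.mem_iff hx]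
  exact ⟨fun hy => ⟨_, hy, by ring⟩, fun ⟨u, hu, hy⟩ => by rw [hy]; simpa using hu⟩

theorem isNeutrix (h : IsExt α) (h0 : (0 : ℝ*) ∈ α) : IsNeutrix α := by
  rw [h.eq_coset h0, coset_zero]
  exact h.isNeutrix_Nx

theorem ordConnected (h : IsExt α) : α.OrdConnected := by
  refine ⟨fun x hx y hy z hz => ?_⟩
  rw [h.mem_iff hx]
  exact h.isNeutrix_Nx.2.2.2 0 h.isNeutrix_Nx.zero_mem _ ((h.mem_iff hx).1 hy) _
    (sub_nonneg.2 hz.1) (sub_le_sub_right hz.2 x)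

theorem abs_le_of_mem_Nx (h : IsExt α) (h0 : Zeroless α) {x u : ℝ*} (hx : x ∈ α)
    (hu : u ∈ Nx α) : |u| ≤ |x| := by
  by_contra hlt
  refine h0 ((h.mem_iff hx).2 (h.isNeutrix_Nx.mem_of_abs_le_s19 (h.isNeutrix_Nx.abs_mem hu) ?_))
  rw [zero_sub, abs_neg]
  exact (not_le.1 hlt).le

theorem add_s19 (hα : IsExt α) (hβ : IsExt β) : IsExt (α + β) := by
  obtain ⟨a, A, hA, rfl⟩ := hα
  obtain ⟨b, B, hB, rfl⟩ := hβ
  refine ⟨a + b, A + B, hA.add_s19 hB, ?_⟩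
  ext z
  constructor
  · rintro ⟨_, ⟨u, hu, rfl⟩, _, ⟨v, hv, rfl⟩, rfl⟩
    exact ⟨u + v, ⟨u, hu, v, hv, rfl⟩, by ring⟩
  · rintro ⟨_, ⟨u, hu, v, hv, rfl⟩, rfl⟩
    exact ⟨a + u, ⟨u, hu, rfl⟩, b + v, ⟨v, hv, rfl⟩, by ring⟩

theorem singleton (a : ℝ*) : IsExt ({a} : Set ℝ*) :=
  ⟨a, {0}, IsNeutrix.singleton_zero, by ext; simp [coset]⟩

theorem esmul (h : IsExt α) (t : ℝ*) : IsExt (esmul t α) := by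
  obtain ⟨a, A, hA, rfl⟩ := h
  refine ⟨t * a, (fun x => t * x) '' A, hA.mul_image t, ?_⟩
  ext z
  constructor
  · rintro ⟨_, ⟨u, hu, rfl⟩, rfl⟩
    exact ⟨t * u, ⟨u, hu, rfl⟩, by ring⟩
  · rintro ⟨_, ⟨u, hu, rfl⟩, rfl⟩
    exact ⟨a + u, ⟨u, hu, rfl⟩, by ring⟩

theorem sum {ι : Type*} (s : Finset ι) {f : ι → Set ℝ*} (hf : ∀ i ∈ s, IsExt (f i)) :
    IsExt (∑ i ∈ s, f i) :=
  Finset.sum_induction f IsExt (fun _ _ => add_s19) (singleton 0) hf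

end IsExt

theorem emul_singleton_one {α : Set ℝ*} (hα : IsExt α) : emul α {1} = α := by
  ext z
  constructor
  · rintro ⟨a, A, b, B, hA, hB, rfl, hb, u, hu, v, hv, u', hu', v', hv', rfl⟩
    have hB0 : B = {0} := by
      rw [← Nx_coset hB (a := b), ← hb]
      ext
      simp [Nx]
    subst hB0
    obtain rfl : b = 1 := by
      have : b ∈ ({1} : Set ℝ*) := hb ▸ ⟨0, rfl, by simp⟩
      simpa using this
    obtain rfl : v = 0 := hv
    obtain rfl : v' = 0 := hv'
    exact ⟨u, hu, by ring⟩
  · intro hz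
    exact ⟨z, Nx α, 1, {0}, hα.isNeutrix_Nx, IsNeutrix.singleton_zero, hα.eq_coset hz,
      by ext; simp [coset], 0, hα.isNeutrix_Nx.zero_mem, 0, rfl, 0, hα.isNeutrix_Nx.zero_mem, 0,
      rfl, by ring⟩

/-- Every element of a product of external numbers is close to the product of any two
representatives. -/
theorem exists_abs_sub_le_of_mem_emul {α β : Set ℝ*} {a b z : ℝ*} (ha : a ∈ α) (hb : b ∈ β)
    (hz : z ∈ emul α β) :
    ∃ u ∈ Nx α, ∃ v ∈ Nx β, 0 ≤ u ∧ 0 ≤ v ∧ |z - a * b| ≤ |a| * v + |b| * u + u * v := by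
  obtain ⟨a', A, b', B, hA, hB, rfl, rfl, u, hu, v, hv, u', hu', v', hv', rfl⟩ := hz
  obtain ⟨d, hd, rfl⟩ := ha
  obtain ⟨e, he, rfl⟩ := hb
  rw [Nx_coset hA, Nx_coset hB]
  refine ⟨|d| + |u| + |u'|,
    hA.add_mem (hA.add_mem (hA.abs_mem hd) (hA.abs_mem hu)) (hA.abs_mem hu'),
    |e| + |v| + |v'|,
    hB.add_mem (hB.add_mem (hB.abs_mem he) (hB.abs_mem hv)) (hB.abs_mem hv'),
    by positivity, by positivity, ?_⟩
  have h1 : |(a' + d) * (v - e)| ≤ |a' + d| * (|e| + |v| + |v'|) := by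
    rw [abs_mul]
    gcongr
    linarith [abs_sub v e, abs_nonneg v']
  have h2 : |(b' + e) * (u - d)| ≤ |b' + e| * (|d| + |u| + |u'|) := by
    rw [abs_mul]
    gcongr
    linarith [abs_sub u d, abs_nonneg u']
  have h3 : |d * e - d * v - e * u + u' * v'| ≤ (|d| + |u| + |u'|) * (|e| + |v| + |v'|) := by
    have := abs_add_le (d * e - d * v - e * u) (u' * v')
    have := abs_sub (d * e - d * v) (e * u)
    have := abs_sub (d * e) (d * v)
    simp only [abs_mul] at *
    have : 0 ≤ |d| * |v'| + |u| * |v| + |u| * |v'| + |u'| * |e| + |u'| * |v| := by positivity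
    linarith
  have heq : a' * b' + a' * v + b' * u + u' * v' - (a' + d) * (b' + e) =
      (a' + d) * (v - e) + (b' + e) * (u - d) + (d * e - d * v - e * u + u' * v') := by ring
  rw [heq]
  have := abs_add_three ((a' + d) * (v - e)) ((b' + e) * (u - d))
    (d * e - d * v - e * u + u' * v')
  linarith

theorem detE_fin_two (M : Matrix (Fin 2) (Fin 2) (Set ℝ*)) (hM : ∀ i j, IsExt (M i j)) :
    detE M = emul (M 0 0) (M 1 1) + esmul (-1) (emul (M 0 1) (M 1 0)) := by
  have huniv : (Finset.univ : Finset (Equiv.Perm (Fin 2))) = {1, Equiv.swap 0 1} := by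
    decide
  rw [detE, huniv, Finset.sum_pair (by decide)]
  simp [eprod, esmul, emul_singleton_one (hM _ _)]

/-- The estimate on representatives encoded by a vanishing minor of order two. -/
theorem exists_abs_le_of_not_hasZerolessMinor_two {m n : ℕ}
    {M : Matrix (Fin m) (Fin n) (Set ℝ*)} (hM : ∀ i j, IsExt (M i j))
    (hmr : ¬ HasZerolessMinor M 2) {i k : Fin m} {j l : Fin n} (hik : i ≠ k) (hjl : j ≠ l)
    {a b c d : ℝ*} (ha : a ∈ M i j) (hb : b ∈ M k l) (hc : c ∈ M i l) (hd : d ∈ M k j) :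
    ∃ ua ∈ Nx (M i j), ∃ ub ∈ Nx (M k l), ∃ uc ∈ Nx (M i l), ∃ ud ∈ Nx (M k j),
      0 ≤ ua ∧ 0 ≤ ub ∧ 0 ≤ uc ∧ 0 ≤ ud ∧
      |a * b - c * d| ≤
        |a| * ub + |b| * ua + ua * ub + (|c| * ud + |d| * uc + uc * ud) := by
  have h0 : (0 : ℝ*) ∈ detE fun r s => M (![i, k] r) (![j, l] s) := by
    by_contra h
    refine hmr ⟨![i, k], ![j, l], ?_, ?_, h⟩
    · intro x y; fin_cases x <;> fin_cases y <;> simp [hik, hik.symm]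
    · intro x y; fin_cases x <;> fin_cases y <;> simp [hjl, hjl.symm]
  rw [detE_fin_two _ fun _ _ => hM _ _] at h0
  obtain ⟨p, hp, _, ⟨q, hq, rfl⟩, hpq⟩ := h0
  simp only [Matrix.cons_val_zero, Matrix.cons_val_one] at hp hq hpq
  obtain ⟨ua, hua, ub, hub, ua0, ub0, h1⟩ := exists_abs_sub_le_of_mem_emul ha hb hp
  obtain ⟨uc, huc, ud, hud, uc0, ud0, h2⟩ := exists_abs_sub_le_of_mem_emul hc hd hq
  refine ⟨ua, hua, ub, hub, uc, huc, ud, hud, ua0, ub0, uc0, ud0, ?_⟩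
  have heq : a * b - c * d = (q - c * d) - (p - a * b) := by linarith
  rw [heq]
  linarith [abs_sub (q - c * d) (p - a * b)]

theorem einv_eq_coset {α : Set ℝ*} (hα : IsExt α) (h0 : Zeroless α) {a : ℝ*} (ha : a ∈ α) :
    einv α = coset a⁻¹ ((fun u => (a ^ 2)⁻¹ * u) '' Nx α) := by
  have hne : ∀ {b : ℝ*}, b ∈ α → b ≠ 0 := fun hb h => h0 (h ▸ hb)
  ext z
  constructor
  · rintro ⟨b, A, hA, rfl, u, hu, rfl⟩
    have hb : b ∈ coset b A := ⟨0, hA.zero_mem, by simp⟩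
    have ha0 := hne ha
    have hb0 := hne hb
    obtain ⟨d, hd, rfl⟩ := ha
    have hr : |(b + d) / b| ≤ 2 := by
      rw [abs_div, div_le_iff₀ (abs_pos.2 hb0)]
      have := hα.abs_le_of_mem_Nx h0 hb (by rwa [Nx_coset hA] : d ∈ _)
      linarith [abs_add_le b d]
    refine ⟨_, ⟨d * ((b + d) / b) + u * ((b + d) / b) ^ 2, ?_, rfl⟩, ?_⟩
    · rw [Nx_coset hA]
      refine hA.mem_of_abs_le_s19 (hA.add_mem (hA.ofNat_mul_mem (hA.abs_mem hd) 2)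
        (hA.ofNat_mul_mem (hA.abs_mem hu) 4)) ?_
      refine (abs_add_le _ _).trans (add_le_add ?_ ?_)
      · rw [abs_mul, mul_comm]
        gcongr
      · rw [abs_mul, abs_pow, mul_comm]
        gcongr
        nlinarith [abs_nonneg ((b + d) / b)]
    · field_simp
      ring
  · rintro ⟨_, ⟨u, hu, rfl⟩, rfl⟩
    exact ⟨a, Nx α, hα.isNeutrix_Nx, hα.eq_coset ha, u, hu, by field_simp⟩

theorem div_mem_ediv {N α : Set ℝ*} (hN : IsNeutrix N) (hα : IsExt α) (h0 : Zeroless α)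
    {a u : ℝ*} (ha : a ∈ α) (hu : u ∈ N) : u / a ∈ ediv N α :=
  ⟨0, N, a⁻¹, _, hN, hα.isNeutrix_Nx.mul_image _, (coset_zero N).symm,
    einv_eq_coset hα h0 ha, u, hu, 0, (hα.isNeutrix_Nx.mul_image _).zero_mem, 0, hN.zero_mem, 0,
    (hα.isNeutrix_Nx.mul_image _).zero_mem, by rw [div_eq_mul_inv]; ring⟩

section Reduced

variable {m n : ℕ} {M : Matrix (Fin m) (Fin n) (Set ℝ*)}

theorem abs_mem_eabs {α : Set ℝ*} (hα : IsExt α) {z : ℝ*} (hz : z ∈ α) : |z| ∈ eabs α :=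
  ⟨z, Nx α, hα.isNeutrix_Nx, hα.eq_coset hz, 0, hα.isNeutrix_Nx.zero_mem, by simp⟩

theorem IsReducedMat.abs_le_two (hM : ∀ i j, IsExt (M i j)) (h : IsReducedMat M) {i : Fin m}
    {j : Fin n} {z : ℝ*} (hz : z ∈ M i j) : |z| ≤ 2 := by
  obtain ⟨A₀, -, hA, -, hle⟩ := h
  obtain ⟨_, ⟨u, hu, rfl⟩, hzu⟩ := hle i j _ (abs_mem_eabs (hM i j) hz)
  obtain ⟨-, hu1⟩ := hA hu 1 one_pos
  simp only [Hyperreal.coe_zero, Hyperreal.coe_one, zero_add] at hu1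
  linarith

theorem IsReducedMat.abs_le_four_of_mem_Nx (hM : ∀ i j, IsExt (M i j)) (h : IsReducedMat M)
    {i : Fin m} {j : Fin n} {u : ℝ*} (hu : u ∈ Nx (M i j)) : |u| ≤ 4 := by
  obtain ⟨x, hx, y, hy, rfl⟩ := hu
  linarith [abs_sub x y, h.abs_le_two hM hx, h.abs_le_two hM hy]

theorem IsReducedMat.exists_half_le_abs (hM : ∀ i j, IsExt (M i j)) (h : IsReducedMat M) :
    ∃ i j, ∀ z ∈ M i j, 1 / 2 ≤ |z| := by
  obtain ⟨A₀, -, hA, ⟨i, j, hij⟩, -⟩ := h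
  refine ⟨i, j, fun z hz => ?_⟩
  obtain ⟨u, hu, hzu⟩ : |z| ∈ coset 1 A₀ := hij ▸ abs_mem_eabs (hM i j) hz
  obtain ⟨hu1, -⟩ := hA hu (1 / 2) (by norm_num)
  push_cast at hu1
  linarith

/-- A reduced matrix with a common neutrix part and no zeroless minor of order two has a
representative which is an outer product. -/
theorem exists_mul_mem_of_common_neutrix (hM : ∀ i j, IsExt (M i j)) (hred : IsReducedMat M)
    (hmr : ¬ HasZerolessMinor M 2) {A : Set ℝ*} (hA : IsNeutrix A) (hN : ∀ i j, Nx (M i j) = A) :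
    ∃ (x : Fin m → ℝ*) (y : Fin n → ℝ*), ∀ i j, x i * y j ∈ M i j := by
  obtain ⟨p, q, hpq⟩ := hred.exists_half_le_abs hM
  choose w hw using fun i j => (hM i j).nonempty
  have hw0 : w p q ≠ 0 := by
    intro h
    have := hpq _ (hw p q)
    rw [h] at this
    norm_num at this
  refine ⟨fun i => w i q, fun j => w p j / w p q, fun i j => ?_⟩
  rcases eq_or_ne p i with rfl | hi
  · simpa [mul_div_cancel₀ _ hw0] using hw p j
  rcases eq_or_ne q j with rfl | hj
  · simpa [div_self hw0] using hw i q
  obtain ⟨ua, hua, ub, hub, uc, huc, ud, hud, ua0, ub0, uc0, ud0, hle⟩ :=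
    exists_abs_le_of_not_hasZerolessMinor_two hM hmr hi hj (hw p q) (hw i j) (hw p j) (hw i q)
  have hua4 := hred.abs_le_four_of_mem_Nx hM hua
  have huc4 := hred.abs_le_four_of_mem_Nx hM huc
  rw [abs_of_nonneg ua0] at hua4
  rw [abs_of_nonneg uc0] at huc4
  rw [hN] at hua hub huc hud
  have hU : 12 * ub + 12 * ud + (4 * ua + 4 * uc) ∈ A :=
    hA.add_mem (hA.add_mem (hA.ofNat_mul_mem hub _) (hA.ofNat_mul_mem hud _))
      (hA.add_mem (hA.ofNat_mul_mem hua _) (hA.ofNat_mul_mem huc _))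
  rw [(hM i j).mem_iff (hw i j), hN]
  refine hA.mem_of_abs_le_s19 hU ?_
  have heq : w i q * (w p j / w p q) - w i j =
      -((w p q * w i j - w p j * w i q) / w p q) := by
    field_simp
    ring
  rw [heq, abs_neg, abs_div, div_le_iff₀ (abs_pos.2 hw0)]
  have hb : ∀ i j, |w i j| ≤ 2 := fun i j => hred.abs_le_two hM (hw i j)
  have hU0 : 0 ≤ 12 * ub + 12 * ud + (4 * ua + 4 * uc) := by positivity
  have h1 := mul_le_mul_of_nonneg_right (hb p q) ub0
  have h2 := mul_le_mul_of_nonneg_right (hb i j) ua0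
  have h3 := mul_le_mul_of_nonneg_right hua4 ub0
  have h4 := mul_le_mul_of_nonneg_right (hb p j) ud0
  have h5 := mul_le_mul_of_nonneg_right (hb i q) uc0
  have h6 := mul_le_mul_of_nonneg_right huc4 ud0
  have h7 := mul_le_mul_of_nonneg_left (hpq _ (hw p q)) hU0
  linarith

/-- A multiplier of the column representative `x` representing column `j` exists as soon as each
pair of entries of column `j` admits one. -/
theorem exists_forall_mul_mem_of_pairwise {ι : Type*} [Fintype ι] {α : ι → Set ℝ*}
    (hα : ∀ i, IsExt (α i)) (x : ι → ℝ*)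
    (h : ∀ i k, ∃ y, x i * y ∈ α i ∧ x k * y ∈ α k) : ∃ y, ∀ i, x i * y ∈ α i := by
  have hconv : ∀ i ∈ Finset.univ, Convex ℝ* {y | x i * y ∈ α i} := by
    intro i _
    exact (hα i).ordConnected.convex.linear_preimage (LinearMap.mulLeft ℝ* (x i))
  obtain ⟨y, hy⟩ := Convex.helly_theorem' hconv (by
    intro I _ hI
    rw [Module.finrank_self] at hI
    rcases I.eq_empty_or_nonempty with rfl | ⟨i, hi⟩
    · simp
    obtain ⟨k, hk⟩ : ∃ k, I ⊆ {i, k} := by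
      by_cases hex : ∃ k ∈ I, k ≠ i
      · obtain ⟨k, hk, hki⟩ := hex
        refine ⟨k, (Finset.eq_of_subset_of_card_le ?_ ?_).symm.subset⟩
        · intro l hl
          rcases Finset.mem_insert.1 hl with rfl | hl
          · exact hi
          · rwa [Finset.mem_singleton.1 hl]
        · rwa [Finset.card_pair hki.symm]
      · push Not at hex
        exact ⟨i, fun l hl => by simp [hex l hl]⟩
    obtain ⟨y, hyi, hyk⟩ := h i k
    refine ⟨y, Set.mem_iInter₂.2 fun l hl => ?_⟩
    rcases Finset.mem_insert.1 (hk hl) with rfl | hl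
    · exact hyi
    · rw [Finset.mem_singleton.1 hl]
      exact hyk)
  exact ⟨y, fun i => Set.mem_iInter₂.1 hy i (Finset.mem_univ i)⟩

/-- If the neutrix parts of column `q`, divided by a zeroless entry of that column, lie in the
neutrix parts of all the other columns, then a reduced matrix with no zeroless minor of order two
has a representative which is an outer product. -/
theorem exists_mul_mem_of_div_subset {p : Fin m} {q : Fin n} (hM : ∀ i j, IsExt (M i j))
    (hred : IsReducedMat M) (hmr : ¬ HasZerolessMinor M 2) (hzl : Zeroless (M p q))
    {a : ℝ*} (ha : a ∈ M p q)
    (hdiv : ∀ i k j, j ≠ q → ∀ u ∈ Nx (M i q), u / a ∈ Nx (M k j)) :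
    ∃ (x : Fin m → ℝ*) (y : Fin n → ℝ*), ∀ i j, x i * y j ∈ M i j := by
  have ha0 : a ≠ 0 := fun h => hzl (h ▸ ha)
  have hapos := abs_pos.2 ha0
  obtain ⟨x, hx, hxp, hx0⟩ : ∃ x : Fin m → ℝ*, (∀ i, x i ∈ M i q) ∧ x p = a ∧
      ∀ i, ¬ Zeroless (M i q) → x i = 0 := by
    choose w hw using fun i => (hM i q).nonempty
    refine ⟨fun i => if i = p then a else if Zeroless (M i q) then w i else 0, ?_, by simp, ?_⟩
    · intro i
      by_cases hi : i = p
      · simpa [hi] using ha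
      · by_cases hz : Zeroless (M i q)
        · simpa [hi, hz] using hw i
        · simpa [hi, hz] using not_not.1 hz
    · intro i hz
      have hi : i ≠ p := fun h => hz (h ▸ hzl)
      simp [hi, hz]
  have hxne : ∀ i, Zeroless (M i q) → x i ≠ 0 := fun i hz h => hz (h ▸ hx i)
  have hdiv' : ∀ i k j, j ≠ q → ∀ u ∈ Nx (M i q), u / |a| ∈ Nx (M k j) := by
    intro i k j hj u hu
    have hN := (hM k j).isNeutrix_Nx
    refine hN.mem_of_abs_le_s19 (hN.abs_mem (hdiv i k j hj u hu)) ?_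
    rw [abs_div, abs_div, abs_abs]
  have hcol : ∀ j, j ≠ q → ∃ y, ∀ i, x i * y ∈ M i j := by
    intro j hj
    have hN := fun i => (hM i j).isNeutrix_Nx
    choose w hw using fun i => (hM i j).nonempty
    have hw2 : ∀ i, |w i| ≤ 2 := fun i => hred.abs_le_two hM (hw i)
    have hpivot : ∀ i, i ≠ p → ∃ c ∈ Nx (M i j), ∃ d ∈ Nx (M p j),
        a * w i - w p * x i = a * c + x i * d := by
      intro i hi
      obtain ⟨ua, hua, ub, hub, uc, huc, ud, hud, ua0, ub0, uc0, ud0, hle⟩ :=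
        exists_abs_le_of_not_hasZerolessMinor_two hM hmr hi.symm hj.symm ha (hw i) (hw p) (hx i)
      have hV : 2 * ub + (2 * (ua / |a|) + 6 * (ud / |a|)) ∈ Nx (M i j) :=
        (hN i).add_mem ((hN i).ofNat_mul_mem hub 2) ((hN i).add_mem
          ((hN i).ofNat_mul_mem (hdiv' p i j hj _ hua) 2)
          ((hN i).ofNat_mul_mem (hdiv' i i j hj _ hud) 6))
      refine (hN i).exists_eq_mul_add_mul (hN p) hV huc (hle.trans ?_)
      have huaa := (hM p q).abs_le_of_mem_Nx hzl ha hua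
      have huc4 := hred.abs_le_four_of_mem_Nx hM huc
      rw [abs_of_nonneg ua0] at huaa
      rw [abs_of_nonneg uc0] at huc4
      have h1 := mul_le_mul_of_nonneg_right (hw2 i) ua0
      have h2 := mul_le_mul_of_nonneg_right huaa ub0
      have h3 := mul_le_mul_of_nonneg_right (hw2 p) ud0
      have h4 := mul_le_mul_of_nonneg_right huc4 ud0
      have heq : |a| * (2 * ub + (2 * (ua / |a|) + 6 * (ud / |a|))) =
          2 * (|a| * ub) + (2 * ua + 6 * ud) := by
        field_simp
      rw [heq]
      linarith
    have hzero : ∀ i, ¬ Zeroless (M i q) → (0 : ℝ*) ∈ M i j := by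
      intro i hz
      have hi : i ≠ p := fun h => hz (h ▸ hzl)
      obtain ⟨c, hc, d, -, h⟩ := hpivot i hi
      rw [hx0 i hz] at h
      have hwc : w i = c := mul_left_cancel₀ ha0 (by linarith)
      simpa [hwc] using (hM i j).sub_mem (hw i) hc
    have hsmall : ∀ i, i ≠ p → ∃ c ∈ Nx (M i j), 0 ≤ c ∧ |w i| ≤ c + 2 * (|x i| / |a|) := by
      intro i hi
      obtain ⟨c, hc, d, hd, h⟩ := hpivot i hi
      refine ⟨|c|, (hN i).abs_mem hc, abs_nonneg c, ?_⟩
      have hwi : w i = c + x i / a * (w p + d) := by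
        field_simp
        linarith
      have hb := hred.abs_le_two hM ((hM p j).add_mem (hw p) hd)
      calc |w i| ≤ |c| + |x i / a * (w p + d)| := by
            rw [hwi]
            exact abs_add_le _ _
        _ ≤ |c| + 2 * (|x i| / |a|) := by
            rw [abs_mul, abs_div, mul_comm 2]
            gcongr
    have hpair : ∀ i k, i ≠ k → Zeroless (M i q) → Zeroless (M k q) →
        ∃ c ∈ Nx (M k j), ∃ d ∈ Nx (M i j), x i * w k - w i * x k = x i * c + x k * d := by
      intro i k hik hzi hzk
      rcases eq_or_ne i p with rfl | hi
      · rw [hxp]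
        exact hpivot k hik.symm
      rcases eq_or_ne k p with rfl | hk
      · obtain ⟨c, hc, d, hd, h⟩ := hpivot i hi
        rw [hxp]
        exact ⟨-d, (hN k).neg_mem hd, -c, (hN i).neg_mem hc, by linarith⟩
      obtain ⟨ci, hci, ci0, hwi⟩ := hsmall i hi
      obtain ⟨ck, hck, ck0, hwk⟩ := hsmall k hk
      obtain ⟨ua, hua, ub, hub, uc, huc, ud, hud, ua0, ub0, uc0, ud0, hle⟩ :=
        exists_abs_le_of_not_hasZerolessMinor_two hM hmr hik hj.symm (hx i) (hw k) (hw i) (hx k)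
      have hV : 2 * ub + (ck + 2 * (ud / |a|)) ∈ Nx (M k j) :=
        (hN k).add_mem ((hN k).ofNat_mul_mem hub 2)
          ((hN k).add_mem hck ((hN k).ofNat_mul_mem (hdiv' k k j hj _ hud) 2))
      have hW : 2 * uc + (ci + 2 * (ua / |a|)) ∈ Nx (M i j) :=
        (hN i).add_mem ((hN i).ofNat_mul_mem huc 2)
          ((hN i).add_mem hci ((hN i).ofNat_mul_mem (hdiv' i i j hj _ hua) 2))
      refine (hN k).exists_eq_mul_add_mul (hN i) hV hW (hle.trans ?_)
      have huai := (hM i q).abs_le_of_mem_Nx hzi (hx i) hua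
      have hudk := (hM k q).abs_le_of_mem_Nx hzk (hx k) hud
      rw [abs_of_nonneg ua0] at huai
      rw [abs_of_nonneg ud0] at hudk
      have h1 := mul_le_mul_of_nonneg_right hwk ua0
      have h2 := mul_le_mul_of_nonneg_right hwi ud0
      have h3 := mul_le_mul_of_nonneg_right huai ub0
      have h4 := mul_le_mul_of_nonneg_right hudk uc0
      have h5 := mul_le_mul_of_nonneg_right huai ck0
      have h6 := mul_le_mul_of_nonneg_right hudk ci0
      have h7 : |x k| / |a| * ua = |x k| * (ua / |a|) := by ring
      have h8 : |x i| / |a| * ud = |x i| * (ud / |a|) := by ring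
      linarith
    refine exists_forall_mul_mem_of_pairwise (fun i => hM i j) x fun i k => ?_
    have hsingle : ∀ i, ∃ y, x i * y ∈ M i j := by
      intro i
      by_cases hz : Zeroless (M i q)
      · exact ⟨w i / x i, by simpa [mul_div_cancel₀ _ (hxne i hz)] using hw i⟩
      · exact ⟨0, by simpa using hzero i hz⟩
    by_cases hzi : Zeroless (M i q)
    · by_cases hzk : Zeroless (M k q)
      · rcases eq_or_ne i k with rfl | hik
        · obtain ⟨y, hy⟩ := hsingle i
          exact ⟨y, hy, hy⟩
        obtain ⟨c, hc, d, hd, h⟩ := hpair i k hik hzi hzk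
        have hi0 := hxne i hzi
        refine ⟨(w i + d) / x i, ?_, ?_⟩
        · rw [mul_div_cancel₀ _ hi0]
          exact (hM i j).add_mem (hw i) hd
        · have : x k * ((w i + d) / x i) = w k - c := by
            field_simp
            linarith
          rw [this]
          exact (hM k j).sub_mem (hw k) hc
      · obtain ⟨y, hy⟩ := hsingle i
        exact ⟨y, hy, by simpa [hx0 k hzk] using hzero k hzk⟩
    · obtain ⟨y, hy⟩ := hsingle k
      exact ⟨y, by simpa [hx0 i hzi] using hzero i hzi, hy⟩
  choose y hy using hcol
  refine ⟨x, fun j => if h : j = q then 1 else y j h, fun i j => ?_⟩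
  by_cases h : j = q
  · subst h
    simpa using hx i
  · simpa [h] using hy j h i

end Reduced

section RowRank

variable {m n : ℕ} {M : Matrix (Fin m) (Fin n) (Set ℝ*)}

theorem linDepE_of_mul_mem {ι : Type*} [Fintype ι] {ξ : ι → Fin n → Set ℝ*}
    (hξ : ∀ i j, IsExt (ξ i j)) {x : ι → ℝ*} {y : Fin n → ℝ*}
    (hxy : ∀ i j, x i * y j ∈ ξ i j) (hι : 1 < Fintype.card ι) : LinDepE ξ := by
  have hdep : ¬ LinearIndependent ℝ* x := by
    intro h
    have := h.fintype_card_le_finrank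
    rw [Module.finrank_self] at this
    omega
  obtain ⟨t, ht, i, hi⟩ := Fintype.not_linearIndependent_iff.1 hdep
  refine ⟨t, ⟨i, hi⟩, fun j => ∑ i, esmul (t i) (ξ i j), fun j => ?_, fun _ => rfl⟩
  refine (IsExt.sum _ fun i _ => (hξ i j).esmul (t i)).isNeutrix ?_
  have h0 : (0 : ℝ*) = ∑ i, t i * (x i * y j) := by
    simp only [smul_eq_mul] at ht
    simp only [← mul_assoc]
    rw [← Finset.sum_mul, ht, zero_mul]
  rw [h0]
  exact Set.finsetSum_mem_finsetSum _ _ _ fun i _ => ⟨_, hxy i j, rfl⟩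

theorem rowRankIs_one_of_mul_mem (hM : ∀ i j, IsExt (M i j)) {i₀ : Fin m} {j₀ : Fin n}
    (hzl : Zeroless (M i₀ j₀)) {x : Fin m → ℝ*} {y : Fin n → ℝ*}
    (hxy : ∀ i j, x i * y j ∈ M i j) : rowRankIs M 1 := by
  refine ⟨⟨{i₀}, Finset.card_singleton i₀, ?_⟩, fun s hs => ?_⟩
  · rintro ⟨t, ⟨⟨i, hi⟩, hti⟩, A, hA, hsum⟩
    obtain rfl := Finset.mem_singleton.1 hi
    have h := hsum j₀
    rw [Fintype.sum_eq_single ⟨i, hi⟩ (by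
      rintro ⟨k, hk⟩ hne
      exact absurd (Subtype.ext (Finset.mem_singleton.1 hk)) hne)] at h
    obtain ⟨z, hz, hz0⟩ : (0 : ℝ*) ∈ esmul (t ⟨i, hi⟩) (M i j₀) := h ▸ (hA j₀).zero_mem
    obtain rfl := (mul_eq_zero.1 hz0).resolve_left hti
    exact hzl hz
  · by_contra hcard
    exact hs (linDepE_of_mul_mem (fun i j => hM i.1 j) (x := fun i => x i.1)
      (fun i j => hxy i.1 j) (by simpa using hcard))

end RowRank

theorem stmt19 {m n : ℕ} (M : Matrix (Fin (m + 1)) (Fin (n + 1)) (Set ℝ*))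
    (hM : ∀ i j, IsExt (M i j)) (hred : IsReducedMat M)
    (hmr : minorRankIs M 1) (hzl : Zeroless (M 0 0))
    (Abar1 : Set ℝ*)
    (hAbar1 : ∃ i, Abar1 = Nx (M i 0)) (hAbar2 : ∀ i, Nx (M i 0) ⊆ Abar1)
    (hcond : (∀ i j, j ≠ 0 → ediv Abar1 (M 0 0) ⊆ Nx (M i j)) ∨
      ∃ A0, IsNeutrix A0 ∧ ∀ i j, Nx (M i j) = A0) :
    rowRankIs M 1 ∧
      ∃ Mhat : Matrix (Fin (m + 1)) (Fin (n + 1)) ℝ*,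
        (∀ i j, Mhat i j ∈ M i j) ∧ Mhat.rank = 1 := by
  have hmr2 : ¬ HasZerolessMinor M 2 := fun h => absurd (hmr.2 2 h) (by norm_num)
  obtain ⟨x, y, hxy⟩ : ∃ (x : Fin (m + 1) → ℝ*) (y : Fin (n + 1) → ℝ*),
      ∀ i j, x i * y j ∈ M i j := by
    rcases hcond with hdiv | ⟨A, hA, hN⟩
    · obtain ⟨a, ha⟩ := (hM 0 0).nonempty
      obtain ⟨r, rfl⟩ := hAbar1
      exact exists_mul_mem_of_div_subset hM hred hmr2 hzl ha fun i k j hj u hu =>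
        hdiv k j hj (div_mem_ediv (hM r 0).isNeutrix_Nx (hM 0 0) hzl ha (hAbar2 i hu))
    · exact exists_mul_mem_of_common_neutrix hM hred hmr2 hA hN
  refine ⟨rowRankIs_one_of_mul_mem hM hzl hxy, Matrix.vecMulVec x y, hxy, ?_⟩
  refine le_antisymm (Matrix.rank_vecMulVec_le x y) (Nat.one_le_iff_ne_zero.2 fun h => ?_)
  rw [Matrix.rank, Submodule.finrank_eq_zero, LinearMap.range_eq_bot] at h
  have h00 := congrFun (LinearMap.congr_fun h (Pi.single 0 1)) 0
  have h0 : x 0 * y 0 = 0 := by simpa [Matrix.vecMulVec] using h00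
  exact hzl (h0 ▸ hxy 0 0)
end
end
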